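/- Let X be a Banach space, f_1, f_2 : X → X commuting C^1 maps (f_1 ∘ f_2 = f_2 ∘ f_1), K ⊆ X a nonempty compact set with f_1(K) = K and f_2(K) = K, and μ a Borel probability measure on X supported on K that is invariant under both f_1 and f_2. Then there exists a Borel measurable function l_α : X → [−∞, ∞) and a Borel set Γ_0 ⊆ X with μ(Γ_0) = 1 such that for every x ∈ Γ_0, for P_ν-almost every ω ∈ Ω the limit lim_{n→∞} (1/n) log ‖d_x f(n, ω)‖_α exists and equals l_α(x); in particular, the limit is P_ν-almost surely independent of ω. -/

import Mathlib

open MeasureTheory Filter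

/-- The Kuratowski measure of non-compactness of a set `A`: the infimum of all `r > 0`
such that `A` can be covered by finitely many balls of radius at most `r`. -/
noncomputable def alphaMeasure {X : Type*} [SeminormedAddCommGroup X] (A : Set X) : ℝ :=
  sInf {r : ℝ | 0 < r ∧ ∃ S : Finset X, ∃ ρ : X → ℝ,
    (∀ c ∈ S, ρ c ≤ r) ∧ A ⊆ ⋃ c ∈ S, Metric.closedBall c (ρ c)}

/-- The index of compactness `‖g‖_α` of a map `g : X → X`:
`inf {k > 0 : α(g(A)) ≤ k * α(A) for every bounded A ⊆ X}`. -/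
noncomputable def alphaNorm {X : Type*} [SeminormedAddCommGroup X] (g : X → X) : ℝ :=
  sInf {k : ℝ | 0 < k ∧ ∀ A : Set X, Bornology.IsBounded A →
    alphaMeasure (g '' A) ≤ k * alphaMeasure A}

/-- Extended-real logarithm of a nonnegative real number, with `log 0 = -∞`. -/
noncomputable def elog (x : ℝ) : EReal :=
  if x ≤ 0 then (⊥ : EReal) else ((Real.log x : ℝ) : EReal)

/-- The random composition `f(n, ω) = f_{ω_{n-1}} ∘ ⋯ ∘ f_{ω_1} ∘ f_{ω_0}`, with
`f(0, ω) = id`, for generators `f 0, f 1 : X → X`. -/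
def fIter {X : Type*} (f : Fin 2 → X → X) : ℕ → (ℕ → Fin 2) → X → X
  | 0, _, x => x
  | (n + 1), ω, x => f (ω n) (fIter f n ω x)

section LowerLimits

/-- A sequence dominated, up to a shift of the index and a null error, by another one has a
smaller lower limit. -/
lemma liminf_le_liminf_of_shift_le {a b e : ℕ → ℝ} {A : ℝ} (j : ℕ)
    (ha0 : ∀ n, 0 ≤ a n) (hb : ∀ n, b n ≤ A)
    (he : Tendsto e atTop (nhds 0)) (h : ∀ᶠ n in atTop, a (n + j) ≤ b n + e n) :
    liminf a atTop ≤ liminf b atTop := by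
  refine le_of_forall_lt fun c hc => ?_
  obtain ⟨c', hc', hc''⟩ := exists_between hc
  obtain ⟨c₂, hc₂, hc₂'⟩ := exists_between hc'
  have h1 : ∀ᶠ n in atTop, c' < a n :=
    eventually_lt_of_lt_liminf hc'' (isBoundedUnder_of ⟨0, ha0⟩)
  have h2 : ∀ᶠ n in atTop, c' < a (n + j) := (tendsto_add_atTop_nat j).eventually h1
  have h3 : ∀ᶠ n in atTop, e n < c' - c₂ := he.eventually (gt_mem_nhds (by linarith))
  refine hc₂.trans_le (le_liminf_of_le (isBoundedUnder_of ⟨A, hb⟩).isCoboundedUnder_ge ?_)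
  filter_upwards [h2, h3, h] with n k2 k3 k4
  linarith

lemma limsup_le_of_le_sub {a b e : ℕ → ℝ} {c M : ℝ} (hM : 0 ≤ M)
    (ha0 : ∀ n, 0 ≤ a n) (hb0 : ∀ n, 0 ≤ b n)
    (he : Tendsto e atTop (nhds 0)) (h : ∀ᶠ n in atTop, a n ≤ c - M * b n + e n) :
    limsup a atTop ≤ c - M * liminf b atTop := by
  refine le_of_forall_pos_le_add fun δ hδ => ?_
  have h1 : ∀ᶠ n in atTop, liminf b atTop - δ / (2 * (M + 1)) < b n :=
    eventually_lt_of_lt_liminf (sub_lt_self _ (by positivity)) (isBoundedUnder_of ⟨0, hb0⟩)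
  have h3 : ∀ᶠ n in atTop, e n < δ / 2 := he.eventually (gt_mem_nhds (by linarith))
  refine limsup_le_of_le (isBoundedUnder_of ⟨0, ha0⟩).isCoboundedUnder_le ?_
  filter_upwards [h1, h3, h] with n k1 k3 k4
  have k5 : M * (δ / (2 * (M + 1))) ≤ δ / 2 := by
    rw [mul_div_assoc', div_le_div_iff₀ (by positivity) (by positivity)]
    nlinarith
  nlinarith [mul_le_mul_of_nonneg_left k1.le hM]

end LowerLimits

section Subadditive

variable {Z : Type*} [MeasurableSpace Z]

/-- A sequence of measurable functions with `0 ≤ φ n ≤ n * M` that is subadditive along the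
orbits of `F`. -/
structure IsBddSubadditive (F : Z → Z) (φ : ℕ → Z → ℝ) (M : ℝ) : Prop where
  measurable : ∀ n, Measurable (φ n)
  nonneg : ∀ n z, 0 ≤ φ n z
  le_mul : ∀ n z, φ n z ≤ n * M
  add_le : ∀ n m z, φ (n + m) z ≤ φ n z + φ m (F^[n] z)

/-- The lower growth rate `liminf φ n / n`. -/
noncomputable def lowerRate (φ : ℕ → Z → ℝ) (z : Z) : ℝ :=
  liminf (fun n : ℕ => φ n z / n) atTop

namespace IsBddSubadditive

variable {F : Z → Z} {φ : ℕ → Z → ℝ} {M : ℝ}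

lemma bound_nonneg [Nonempty Z] (h : IsBddSubadditive F φ M) : 0 ≤ M := by
  obtain ⟨z⟩ := ‹Nonempty Z›
  simpa using (h.nonneg 1 z).trans (h.le_mul 1 z)

lemma div_nonneg (h : IsBddSubadditive F φ M) (z : Z) (n : ℕ) : 0 ≤ φ n z / n :=
  _root_.div_nonneg (h.nonneg n z) n.cast_nonneg

lemma div_le (h : IsBddSubadditive F φ M) (z : Z) (n : ℕ) : φ n z / n ≤ M := by
  have : Nonempty Z := ⟨z⟩
  exact div_le_of_le_mul₀ n.cast_nonneg h.bound_nonneg (by linarith [h.le_mul n z])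

lemma isBoundedUnder_le (h : IsBddSubadditive F φ M) (z : Z) :
    IsBoundedUnder (· ≤ ·) atTop (fun n : ℕ => φ n z / n) :=
  isBoundedUnder_of ⟨M, h.div_le z⟩

lemma isBoundedUnder_ge (h : IsBddSubadditive F φ M) (z : Z) :
    IsBoundedUnder (· ≥ ·) atTop (fun n : ℕ => φ n z / n) :=
  isBoundedUnder_of ⟨0, h.div_nonneg z⟩

lemma lowerRate_nonneg (h : IsBddSubadditive F φ M) (z : Z) : 0 ≤ lowerRate φ z :=
  le_liminf_of_le (h.isBoundedUnder_le z).isCoboundedUnder_ge (.of_forall (h.div_nonneg z))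

lemma lowerRate_le (h : IsBddSubadditive F φ M) (z : Z) : lowerRate φ z ≤ M :=
  liminf_le_of_le (h.isBoundedUnder_ge z) fun _ hb =>
    let ⟨n, hn⟩ := hb.exists
    hn.trans (h.div_le z n)

lemma measurable_lowerRate (h : IsBddSubadditive F φ M) : Measurable (lowerRate φ) :=
  Measurable.liminf fun n => (h.measurable n).div_const _

/-- If `φ (n + 1) z ≤ M + φ n w` for all `n`, the lower rate at `z` is at most that at `w`. -/
lemma lowerRate_le_lowerRate (h : IsBddSubadditive F φ M) {z w : Z}
    (hzw : ∀ n, φ (n + 1) z ≤ M + φ n w) : lowerRate φ z ≤ lowerRate φ w := by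
  have : Nonempty Z := ⟨z⟩
  refine liminf_le_liminf_of_shift_le 1 (h.div_nonneg z) (h.div_le w)
    (tendsto_const_div_atTop_nhds_zero_nat M) ?_
  filter_upwards [eventually_gt_atTop 0] with n hn
  have hn' : (0 : ℝ) < n := by exact_mod_cast hn
  rw [← add_div, Nat.cast_add_one]
  gcongr
  · linarith [h.nonneg n w, h.bound_nonneg]
  · linarith [hzw n]
  · linarith

lemma lowerRate_le_comp (h : IsBddSubadditive F φ M) (z : Z) :
    lowerRate φ z ≤ lowerRate φ (F z) := by
  refine h.lowerRate_le_lowerRate fun n => ?_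
  have := h.add_le 1 n z
  rw [add_comm 1 n] at this
  simpa using this.trans (add_le_add_left (by simpa using h.le_mul 1 z) _)

end IsBddSubadditive

/-- A bounded function that does not decrease along a measure preserving map is almost
everywhere invariant. -/
lemma ae_eq_comp_of_le_comp {m : Measure Z} [IsProbabilityMeasure m] {F : Z → Z}
    (hF : MeasurePreserving F m m) {g : Z → ℝ} (hg : Integrable g m) (hle : ∀ z, g z ≤ g (F z)) :
    ∀ᵐ z ∂m, g (F z) = g z := by
  have hgF : Integrable (fun z => g (F z)) m := (hF.integrable_comp hg.1).2 hg
  have h0 : ∫ z, (g (F z) - g z) ∂m = 0 := by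
    rw [integral_sub hgF hg, sub_eq_zero]
    have := integral_map (μ := m) hF.aemeasurable (f := g) (by rw [hF.map_eq]; exact hg.1)
    rw [hF.map_eq] at this
    exact this.symm
  have := (integral_eq_zero_iff_of_nonneg (fun z => sub_nonneg.2 (hle z)) (hgF.sub hg)).1 h0
  filter_upwards [this] with z hz
  exact sub_eq_zero.1 hz

/-- A bounded function that does not decrease along a measure preserving map is almost
everywhere constant along orbits. -/
lemma ae_forall_eq_iterate {m : Measure Z} [IsProbabilityMeasure m] {F : Z → Z}
    (hF : MeasurePreserving F m m) {g : Z → ℝ} (hg : Integrable g m) (hle : ∀ z, g z ≤ g (F z)) :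
    ∀ᵐ z ∂m, ∀ k, g (F^[k] z) = g z := by
  have h : ∀ᵐ z ∂m, ∀ k, g (F (F^[k] z)) = g (F^[k] z) :=
    ae_all_iff.2 fun k => (hF.iterate k).quasiMeasurePreserving.ae
      (ae_eq_comp_of_le_comp hF hg hle)
  filter_upwards [h] with z hz k
  induction k with
  | zero => rfl
  | succ k ih => rw [Function.iterate_succ_apply', hz, ih]

namespace IsBddSubadditive

variable {F : Z → Z} {φ : ℕ → Z → ℝ} {M : ℝ}

lemma integrable_lowerRate {m : Measure Z} [IsProbabilityMeasure m]
    (h : IsBddSubadditive F φ M) : Integrable (lowerRate φ) m :=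
  Integrable.of_bound h.measurable_lowerRate.aestronglyMeasurable M (.of_forall fun z => by
    rw [Real.norm_of_nonneg (h.lowerRate_nonneg z)]; exact h.lowerRate_le z)

/-- The orbit decomposition behind the subadditive ergodic theorem: `B` is a measurable set of
small measure outside of which the growth rate of `φ` drops to `l + ε` before time `N`. -/
lemma le_of_orbit (h : IsBddSubadditive F φ M) {B : Set Z} {N : ℕ} {ε l : ℝ}
    (hl : 0 ≤ l + ε)
    (hB : ∀ z ∉ B, ∃ j, 1 ≤ j ∧ j ≤ N ∧ φ j z ≤ j * (lowerRate φ z + ε)) (n : ℕ) :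
    ∀ z, (∀ k, lowerRate φ (F^[k] z) = l) →
      φ n z ≤ n * (l + ε) + M * birkhoffSum F (B.indicator 1) n z + N * M := by
  induction n using Nat.strong_induction_on with
  | _ n ih =>
    intro z hz
    have : Nonempty Z := ⟨z⟩
    have hM := h.bound_nonneg
    have hS : ∀ (n : ℕ) (w : Z), 0 ≤ birkhoffSum F (B.indicator (1 : Z → ℝ)) n w := fun n w =>
      Finset.sum_nonneg fun i _ => Set.indicator_nonneg (fun _ _ => zero_le_one) _
    have hiter : ∀ j k, lowerRate φ (F^[k] (F^[j] z)) = l := fun j k => by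
      rw [← Function.iterate_add_apply]; exact hz _
    rcases le_or_gt n N with hn | hn
    · have h1 : (n : ℝ) * M ≤ N * M := by gcongr
      have h2 : 0 ≤ (n : ℝ) * (l + ε) := by positivity
      linarith [h.le_mul n z, mul_nonneg hM (hS n z)]
    · by_cases hzB : z ∈ B
      · obtain ⟨k, rfl⟩ : ∃ k, n = 1 + k := ⟨n - 1, by omega⟩
        have h1 := ih k (by omega) (F^[1] z) (hiter 1)
        have h2 := h.add_le 1 k z
        have h3 := h.le_mul 1 z
        rw [birkhoffSum_add, birkhoffSum_one, Set.indicator_of_mem hzB]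
        push_cast at h3 ⊢
        simp only [Pi.one_apply]
        nlinarith
      · obtain ⟨j, hj1, hjN, hj⟩ := hB z hzB
        obtain ⟨k, rfl⟩ : ∃ k, n = j + k := ⟨n - j, by omega⟩
        have h1 := ih k (by omega) (F^[j] z) (hiter j)
        have h2 := h.add_le j k z
        rw [show lowerRate φ z = l from hz 0] at hj
        rw [birkhoffSum_add]
        push_cast
        nlinarith [mul_nonneg hM (hS j z)]

/-- A pathwise bound for `φ` by its lower rate and the visits to a set of small measure. -/
lemma exists_set_le {m : Measure Z} [IsProbabilityMeasure m] (hF : MeasurePreserving F m m)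
    (h : IsBddSubadditive F φ M) {ε δ : ℝ} (hε : 0 < ε) (hδ : 0 < δ) :
    ∃ B : Set Z, MeasurableSet B ∧ m.real B ≤ δ ∧ ∃ N : ℕ, ∀ᵐ z ∂m, ∀ n : ℕ,
      φ n z ≤ n * (lowerRate φ z + ε) + M * birkhoffSum F (B.indicator 1) n z + N * M := by
  let B : ℕ → Set Z := fun N => ⋂ j ∈ Set.Icc 1 N, {z | j * (lowerRate φ z + ε) < φ j z}
  have hBm : ∀ N, MeasurableSet (B N) := fun N =>
    MeasurableSet.biInter (Set.to_countable _) fun j _ =>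
      measurableSet_lt ((h.measurable_lowerRate.add_const ε).const_mul _) (h.measurable j)
  have hanti : Antitone B := fun a b hab =>
    Set.biInter_subset_biInter_left (Set.Icc_subset_Icc_right hab)
  have hempty : ⋂ N, B N = ∅ := by
    refine Set.eq_empty_of_forall_notMem fun z hz => ?_
    have hfr : ∃ᶠ n in atTop, φ n z / n < lowerRate φ z + ε :=
      frequently_lt_of_liminf_lt (h.isBoundedUnder_le z).isCoboundedUnder_ge
        (show lowerRate φ z < _ by linarith)
    obtain ⟨n, hn, hn1⟩ := (hfr.and_eventually (eventually_ge_atTop 1)).exists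
    have hz' := Set.mem_iInter₂.1 (Set.mem_iInter.1 hz n) n ⟨hn1, le_rfl⟩
    have hn' : (0 : ℝ) < n := by exact_mod_cast hn1
    rw [div_lt_iff₀ hn'] at hn
    simp only [Set.mem_ofPred_eq] at hz'
    linarith
  have hlim := tendsto_measure_iInter_atTop (μ := m)
    (fun N => (hBm N).nullMeasurableSet) hanti ⟨0, measure_ne_top _ _⟩
  rw [hempty, measure_empty] at hlim
  obtain ⟨N, hN⟩ := (hlim.eventually (ge_mem_nhds (ENNReal.ofReal_pos.2 hδ))).exists
  refine ⟨B N, hBm N, ENNReal.toReal_le_of_le_ofReal hδ.le hN, N, ?_⟩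
  filter_upwards [ae_forall_eq_iterate hF h.integrable_lowerRate h.lowerRate_le_comp]
    with z hz n
  refine h.le_of_orbit (by linarith [h.lowerRate_nonneg z]) (fun w hw => ?_) n z hz
  simp only [B, Set.mem_iInter, Set.mem_ofPred_eq, not_forall, not_lt] at hw
  obtain ⟨j, hj, hj'⟩ := hw
  exact ⟨j, hj.1, hj.2, hj'⟩

end IsBddSubadditive

lemma integral_birkhoffSum {m : Measure Z} {F : Z → Z} (hF : MeasurePreserving F m m) {g : Z → ℝ}
    (hg : Integrable g m) (n : ℕ) :
    Integrable (birkhoffSum F g n) m ∧ ∫ z, birkhoffSum F g n z ∂m = n * ∫ z, g z ∂m := by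
  have hint : ∀ k, Integrable (fun z => g (F^[k] z)) m := fun k =>
    ((hF.iterate k).integrable_comp hg.1).2 hg
  refine ⟨integrable_finsetSum _ fun k _ => hint k, ?_⟩
  simp only [birkhoffSum]
  rw [integral_finsetSum _ fun k _ => hint k]
  have : ∀ k, ∫ z, g (F^[k] z) ∂m = ∫ z, g z ∂m := fun k => by
    have := integral_map (μ := m) (hF.iterate k).aemeasurable (f := g)
      (by rw [(hF.iterate k).map_eq]; exact hg.1)
    rw [(hF.iterate k).map_eq] at this
    exact this.symm
  simp [this]

lemma isBddSubadditive_birkhoffSum {F : Z → Z} (hF : Measurable F) {g : Z → ℝ} (hg : Measurable g)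
    (h0 : ∀ z, 0 ≤ g z) (h1 : ∀ z, g z ≤ 1) : IsBddSubadditive F (birkhoffSum F g) 1 where
  measurable n := Finset.measurable_fun_sum _ fun k _ => hg.comp (hF.iterate k)
  nonneg n z := Finset.sum_nonneg fun k _ => h0 _
  le_mul n z := by
    simpa [birkhoffSum] using Finset.sum_le_sum fun k (_ : k ∈ Finset.range n) => h1 (F^[k] z)
  add_le n k z := (birkhoffSum_add F g n k z).le

/-- One half of the ergodic theorem: `∫ g ≤ ∫ liminf (Birkhoff averages of g)`. -/
lemma integral_le_integral_lowerRate {m : Measure Z} [IsProbabilityMeasure m] {F : Z → Z}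
    (hF : MeasurePreserving F m m) {g : Z → ℝ} (hg : Measurable g)
    (h0 : ∀ z, 0 ≤ g z) (h1 : ∀ z, g z ≤ 1) :
    ∫ z, g z ∂m ≤ ∫ z, lowerRate (birkhoffSum F g) z ∂m := by
  have hsub := isBddSubadditive_birkhoffSum hF.measurable hg h0 h1
  have hgi : Integrable g m := Integrable.of_bound hg.aestronglyMeasurable 1
    (.of_forall fun z => by rw [Real.norm_of_nonneg (h0 z)]; exact h1 z)
  refine le_of_forall_pos_le_add fun ε hε => ?_
  obtain ⟨B, hB, hmB, N, hN⟩ :=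
    hsub.exists_set_le hF (show 0 < ε / 2 by linarith) (show 0 < ε / 2 by linarith)
  have hBi : Integrable (B.indicator (1 : Z → ℝ)) m := (integrable_const 1).indicator hB
  have hL := hsub.integrable_lowerRate (m := m)
  have key : ∀ n : ℕ, (n : ℝ) * ∫ z, g z ∂m ≤
      n * (∫ z, lowerRate (birkhoffSum F g) z ∂m + ε) + N := fun n => by
    have hA : Integrable (fun z => (n : ℝ) * (lowerRate (birkhoffSum F g) z + ε / 2)) m :=
      (hL.add (integrable_const _)).const_mul _
    have hS := integral_birkhoffSum hF hBi n
    have hAS : Integrable (fun z => (n : ℝ) * (lowerRate (birkhoffSum F g) z + ε / 2) +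
        1 * birkhoffSum F (B.indicator 1) n z) m := hA.add (hS.1.const_mul 1)
    have := integral_mono_ae (integral_birkhoffSum hF hgi n).1
      (hAS.add (integrable_const ((N : ℝ) * 1)))
      (hN.mono fun z hz => hz n)
    simp only [Pi.add_apply] at this
    rw [(integral_birkhoffSum hF hgi n).2, integral_add hAS (integrable_const _),
      integral_add hA (hS.1.const_mul 1), integral_const_mul,
      integral_const_mul, hS.2, integral_add hL (integrable_const _),
      integral_indicator_one hB] at this
    simp only [integral_const, probReal_univ, smul_eq_mul, one_mul, mul_one] at this
    nlinarith [mul_le_mul_of_nonneg_left hmB n.cast_nonneg]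
  by_contra! hlt
  obtain ⟨n, hn⟩ := exists_nat_gt
    (N / (∫ z, g z ∂m - (∫ z, lowerRate (birkhoffSum F g) z ∂m + ε)))
  rw [div_lt_iff₀ (by linarith)] at hn
  linarith [key n]

/-- **Subadditive ergodic theorem** for bounded nonnegative sequences. -/
theorem IsBddSubadditive.ae_tendsto {m : Measure Z} [IsProbabilityMeasure m] {F : Z → Z}
    (hF : MeasurePreserving F m m) {φ : ℕ → Z → ℝ} {M : ℝ} (h : IsBddSubadditive F φ M) :
    ∀ᵐ z ∂m, Tendsto (fun n : ℕ => φ n z / n) atTop (nhds (lowerRate φ z)) := by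
  have : Nonempty Z := m.nonempty_of_neZero
  have hM := h.bound_nonneg
  set U : Z → ℝ := fun z => limsup (fun n : ℕ => φ n z / n) atTop with hU
  have hUm : Measurable U := Measurable.limsup fun n => (h.measurable n).div_const _
  have hLU : ∀ z, lowerRate φ z ≤ U z := fun z =>
    liminf_le_limsup (h.isBoundedUnder_le z) (h.isBoundedUnder_ge z)
  have hUM : ∀ z, U z ≤ M := fun z =>
    limsup_le_of_le (h.isBoundedUnder_ge z).isCoboundedUnder_le (.of_forall (h.div_le z))
  have hUi : Integrable U m := Integrable.of_bound hUm.aestronglyMeasurable M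
    (.of_forall fun z => by
      rw [Real.norm_of_nonneg ((h.lowerRate_nonneg z).trans (hLU z))]; exact hUM z)
  have hLi := h.integrable_lowerRate (m := m)
  have hle : ∫ z, U z ∂m ≤ ∫ z, lowerRate φ z ∂m := by
    refine le_of_forall_pos_le_add fun ε hε => ?_
    obtain ⟨B, hB, hmB, N, hN⟩ := h.exists_set_le hF (show 0 < ε / 2 by linarith)
      (show 0 < ε / (2 * (M + 1)) by positivity)
    set g : Z → ℝ := Bᶜ.indicator 1 with hg
    have hgm : Measurable g := measurable_one.indicator hB.compl
    have hg0 : ∀ z, 0 ≤ g z := fun z => Set.indicator_nonneg (fun _ _ => zero_le_one) z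
    have hg1 : ∀ z, g z ≤ 1 := fun z => Set.indicator_le_self' (fun _ _ => zero_le_one) z
    have hsub := isBddSubadditive_birkhoffSum hF.measurable hgm hg0 hg1
    have hsum : ∀ (n : ℕ) z, birkhoffSum F (B.indicator (1 : Z → ℝ)) n z =
        n - birkhoffSum F g n z := fun n z => by
      have : ∀ w, B.indicator (1 : Z → ℝ) w = 1 - g w := fun w => by
        by_cases hw : w ∈ B <;> simp [hg, hw]
      simp [birkhoffSum, this]
    have hUle : ∀ᵐ z ∂m, U z ≤ (lowerRate φ z + (ε / 2 + M)) -
        M * lowerRate (birkhoffSum F g) z := by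
      filter_upwards [hN] with z hz
      refine limsup_le_of_le_sub hM (h.div_nonneg z) (hsub.div_nonneg z)
        (tendsto_const_div_atTop_nhds_zero_nat (N * M)) ?_
      filter_upwards [eventually_gt_atTop 0] with n hn
      have hn' : (0 : ℝ) < n := by exact_mod_cast hn
      have := hz n
      rw [hsum] at this
      rw [div_le_iff₀ hn']
      field_simp
      linarith
    have hG := hsub.integrable_lowerRate (m := m)
    have hLc : Integrable (fun z => lowerRate φ z + (ε / 2 + M)) m :=
      hLi.add (integrable_const _)
    have hint := integral_mono_ae hUi (hLc.sub (hG.const_mul M)) hUle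
    simp only [Pi.sub_apply] at hint
    rw [integral_sub hLc (hG.const_mul M),
      integral_add hLi (integrable_const _), integral_const_mul] at hint
    simp only [integral_const, probReal_univ, smul_eq_mul, one_mul] at hint
    have h2 := integral_le_integral_lowerRate hF hgm hg0 hg1
    rw [hg, integral_indicator_one hB.compl, probReal_compl_eq_one_sub hB] at h2
    have h3 := mul_le_mul_of_nonneg_left h2 hM
    have h4 : M * m.real B ≤ ε / 2 := by
      refine (mul_le_mul_of_nonneg_left hmB hM).trans ?_
      rw [mul_div_assoc', div_le_div_iff₀ (by positivity) (by positivity)]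
      nlinarith
    linarith
  have h0 : ∫ z, (U z - lowerRate φ z) ∂m = 0 := by
    rw [integral_sub hUi hLi]
    linarith [integral_mono hLi hUi hLU]
  have := (integral_eq_zero_iff_of_nonneg (fun z => sub_nonneg.2 (hLU z)) (hUi.sub hLi)).1 h0
  filter_upwards [this] with z hz
  exact tendsto_of_liminf_eq_limsup rfl (sub_eq_zero.1 hz) (h.isBoundedUnder_le z)
    (h.isBoundedUnder_ge z)

end Subadditive

section BernoulliShift

open ProbabilityTheory

/-- The left shift on sequences. -/
def shiftSeq {S : Type*} (ω : ℕ → S) : ℕ → S := fun n => ω (n + 1)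

lemma iterate_shiftSeq {S : Type*} (k : ℕ) (ω : ℕ → S) :
    shiftSeq^[k] ω = fun n => ω (n + k) := by
  induction k with
  | zero => rfl
  | succ k ih =>
    rw [Function.iterate_succ_apply', ih]
    funext n
    simp [shiftSeq, add_right_comm, add_assoc]

/-- A probability measure on sequences that gives initial cylinders the product mass is the
product measure. -/
lemma eq_infinitePi_of_initial_cylinders {S : Type*} [MeasurableSpace S] [Countable S]
    [MeasurableSingletonClass S] (p : Measure S) [IsProbabilityMeasure p] (P : Measure (ℕ → S))
    (hP : ∀ (n : ℕ) (a : Fin n → S), P {ω | ∀ m : Fin n, ω m = a m} = ∏ m : Fin n, p {a m}) :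
    P = Measure.infinitePi fun _ : ℕ => p := by
  classical
  refine Measure.eq_infinitePi _ fun s t ht => ?_
  obtain ⟨n, hn⟩ : ∃ n, s ⊆ Finset.range n := s.exists_nat_subset_range
  let r : (ℕ → S) → (Fin n → S) := fun ω m => ω m
  have hr : Measurable r := by fun_prop
  have hmap : P.map r = Measure.pi fun _ : Fin n => p := by
    refine Measure.ext_of_singleton fun a => ?_
    rw [Measure.pi_singleton, Measure.map_apply hr (measurableSet_singleton a), ← hP]
    congr 1
    ext ω
    simp [r, funext_iff]
  let t' : ℕ → Set S := fun i => if i ∈ s then t i else Set.univ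
  have hset : (s : Set ℕ).pi t = r ⁻¹' Set.univ.pi fun m : Fin n => t' m := by
    ext ω
    simp only [Set.mem_pi, Finset.mem_coe, Set.mem_preimage, Set.mem_univ, true_imp_iff, r, t']
    refine ⟨fun h m => ?_, fun h i hi => ?_⟩
    · split_ifs with hm
      · exact h m hm
      · trivial
    · simpa [hi] using h ⟨i, Finset.mem_range.1 (hn hi)⟩
  have ht' : ∀ i, MeasurableSet (t' i) := fun i => by
    simp only [t']
    split_ifs
    exacts [ht i, .univ]
  rw [hset, ← Measure.map_apply hr (.univ_pi fun m => ht' m), hmap, Measure.pi_pi,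
    Fin.prod_univ_eq_prod_range (fun i => p (t' i)) n, ← Finset.prod_subset hn]
  · exact Finset.prod_congr rfl fun i hi => by simp [t', hi]
  · intro i _ hi
    simp [t', hi]

/-- The left shift preserves a product of copies of a probability measure. -/
lemma measurePreserving_shift_infinitePi {S : Type*} [MeasurableSpace S] (p : Measure S)
    [IsProbabilityMeasure p] :
    MeasurePreserving (shiftSeq (S := S)) (Measure.infinitePi fun _ : ℕ => p)
      (Measure.infinitePi fun _ : ℕ => p) := by
  have hm : Measurable (shiftSeq (S := S)) := by unfold shiftSeq; fun_prop
  refine ⟨hm, Measure.eq_infinitePi _ fun s t ht => ?_⟩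
  rw [Measure.map_apply hm (.pi s.countable_toSet fun _ _ => ht _)]
  have : shiftSeq ⁻¹' (s : Set ℕ).pi t =
      ((s.map (addRightEmbedding 1) : Finset ℕ) : Set ℕ).pi fun i => t (i - 1) := by
    ext ω
    simp [Set.mem_pi, shiftSeq]
  rw [this, Measure.infinitePi_pi _ fun i _ => ht _]
  simp

/-- The left shift is ergodic for a product of copies of a probability measure. -/
lemma ergodic_shift_infinitePi {S : Type*} [MeasurableSpace S] (p : Measure S)
    [IsProbabilityMeasure p] :
    Ergodic (shiftSeq (S := S)) (Measure.infinitePi fun _ : ℕ => p) := by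
  refine ⟨measurePreserving_shift_infinitePi p, ⟨fun s hs hinv => ?_⟩⟩
  have hindep : iIndep (fun n : ℕ => MeasurableSpace.comap (fun ω : ℕ → S => ω n) inferInstance)
      (Measure.infinitePi fun _ : ℕ => p) :=
    iIndepFun_infinitePi (P := fun _ : ℕ => p) (X := fun _ => id) fun _ => measurable_id
  have htail : MeasurableSet[limsup
      (fun n : ℕ => MeasurableSpace.comap (fun ω : ℕ → S => ω n) inferInstance) atTop] s := by
    rw [limsup_eq_iInf_iSup_of_nat, MeasurableSpace.measurableSet_iInf]
    intro N
    have hs' : s = shiftSeq^[N] ⁻¹' s := by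
      clear hindep
      induction N with
      | zero => rfl
      | succ k ih => rw [Function.iterate_succ', Set.preimage_comp, hinv, ← ih]
    rw [hs', funext (iterate_shiftSeq N)]
    refine @measurableSet_preimage _ _ (_) _ _ _ ?_ hs
    refine @measurable_pi_lambda _ _ _ (_) _ _ fun n => ?_
    refine Measurable.mono (comap_measurable fun ω : ℕ → S => ω (n + N)) ?_ le_rfl
    exact le_iSup₂_of_le (n + N) (Nat.le_add_left N n) le_rfl
  rw [eventuallyConst_set']
  rcases measure_zero_or_one_of_measurableSet_limsup_atTop
    (fun n => (measurable_pi_apply n).comap_le) hindep htail with h | h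
  · exact .inl (ae_eq_empty.2 h)
  · exact .inr (ae_eq_univ.2 ((prob_compl_eq_zero_iff hs).2 h))

end BernoulliShift

section IndexOfCompactness

variable {X : Type*} [NormedAddCommGroup X]

lemma alphaMeasure_nonneg (A : Set X) : 0 ≤ alphaMeasure A :=
  Real.sInf_nonneg fun _ hr => hr.1.le

lemma alphaNorm_nonneg (g : X → X) : 0 ≤ alphaNorm g :=
  Real.sInf_nonneg fun _ hr => hr.1.le

lemma exists_cover_of_alphaMeasure_lt {A : Set X} (hA : Bornology.IsBounded A) {r : ℝ}
    (hr : alphaMeasure A < r) : ∃ S : Finset X, A ⊆ ⋃ c ∈ S, Metric.closedBall c r := by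
  obtain ⟨R, hR⟩ := hA.subset_closedBall 0
  have hne : {r : ℝ | 0 < r ∧ ∃ S : Finset X, ∃ ρ : X → ℝ,
      (∀ c ∈ S, ρ c ≤ r) ∧ A ⊆ ⋃ c ∈ S, Metric.closedBall c (ρ c)}.Nonempty :=
    ⟨max R 1, by positivity, {0}, fun _ => R, by simp, by simpa using hR⟩
  obtain ⟨s, ⟨-, S, ρ, hρ, hS⟩, hs⟩ := exists_lt_of_csInf_lt hne hr
  exact ⟨S, hS.trans (Set.iUnion₂_mono fun c hc =>
    Metric.closedBall_subset_closedBall ((hρ c hc).trans hs.le))⟩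

lemma alphaMeasure_le_of_cover {A : Set X} {r : ℝ} (hr : 0 ≤ r) {S : Finset X}
    (hS : A ⊆ ⋃ c ∈ S, Metric.closedBall c r) : alphaMeasure A ≤ r := by
  refine le_of_forall_gt_imp_ge_of_dense fun r' hr' => ?_
  exact csInf_le ⟨0, fun _ h => h.1.le⟩ ⟨hr.trans_lt hr', S, fun _ => r, fun _ _ => hr'.le, hS⟩

lemma alphaNorm_le {g : X → X} {k : ℝ} (hk : 0 ≤ k)
    (h : ∀ A : Set X, Bornology.IsBounded A → alphaMeasure (g '' A) ≤ k * alphaMeasure A) :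
    alphaNorm g ≤ k := by
  refine le_of_forall_gt_imp_ge_of_dense fun k' hk' => ?_
  exact csInf_le ⟨0, fun _ h => h.1.le⟩ ⟨hk.trans_lt hk', fun A hA => (h A hA).trans
    (mul_le_mul_of_nonneg_right hk'.le (alphaMeasure_nonneg A))⟩

variable [NormedSpace ℝ X]

lemma ContinuousLinearMap.isBounded_image (T : X →L[ℝ] X) {A : Set X}
    (hA : Bornology.IsBounded A) : Bornology.IsBounded (T '' A) :=
  T.lipschitz.isBounded_image hA

lemma alphaMeasure_image_le_norm (T : X →L[ℝ] X) {A : Set X} (hA : Bornology.IsBounded A) :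
    alphaMeasure (T '' A) ≤ ‖T‖ * alphaMeasure A := by
  classical
  have key : ∀ r > alphaMeasure A, alphaMeasure (T '' A) ≤ ‖T‖ * r := fun r hr => by
    obtain ⟨S, hS⟩ := exists_cover_of_alphaMeasure_lt hA hr
    have hr0 := (alphaMeasure_nonneg A).trans hr.le
    refine alphaMeasure_le_of_cover (S := S.image T) (by positivity) ?_
    rintro _ ⟨x, hx, rfl⟩
    obtain ⟨c, hc, hxc⟩ := Set.mem_iUnion₂.1 (hS hx)
    refine Set.mem_iUnion₂.2 ⟨T c, Finset.mem_image_of_mem T hc, ?_⟩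
    rw [mem_closedBall_iff_norm] at hxc ⊢
    rw [← map_sub]
    exact T.le_opNorm_of_le hxc
  refine ge_of_tendsto (x := nhdsWithin (alphaMeasure A) (Set.Ioi (alphaMeasure A)))
    (f := fun r => ‖T‖ * r) ?_ (by filter_upwards [self_mem_nhdsWithin] with r hr using key r hr)
  exact ((continuous_const.mul continuous_id).tendsto _).mono_left nhdsWithin_le_nhds

lemma alphaMeasure_image_add_le (T U : X →L[ℝ] X) {A : Set X} (hA : Bornology.IsBounded A) :
    alphaMeasure ((T + U : X →L[ℝ] X) '' A) ≤ alphaMeasure (T '' A) + alphaMeasure (U '' A) := by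
  classical
  refine le_of_forall_pos_le_add fun ε hε => ?_
  obtain ⟨S, hS⟩ := exists_cover_of_alphaMeasure_lt (T.isBounded_image hA)
    (lt_add_of_pos_right _ (half_pos hε))
  obtain ⟨S', hS'⟩ := exists_cover_of_alphaMeasure_lt (U.isBounded_image hA)
    (lt_add_of_pos_right _ (half_pos hε))
  have h1 := alphaMeasure_nonneg (T '' A)
  have h2 := alphaMeasure_nonneg (U '' A)
  refine alphaMeasure_le_of_cover (S := Finset.image₂ (· + ·) S S') (by positivity) ?_
  rintro _ ⟨x, hx, rfl⟩
  obtain ⟨c, hc, hxc⟩ := Set.mem_iUnion₂.1 (hS ⟨x, hx, rfl⟩)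
  obtain ⟨d, hd, hxd⟩ := Set.mem_iUnion₂.1 (hS' ⟨x, hx, rfl⟩)
  refine Set.mem_iUnion₂.2 ⟨c + d, Finset.mem_image₂_of_mem hc hd, ?_⟩
  rw [Metric.mem_closedBall] at *
  have := dist_add_add_le (T x) (U x) c d
  rw [add_apply]
  linarith

lemma alphaMeasure_image_le (T : X →L[ℝ] X) {A : Set X} (hA : Bornology.IsBounded A) :
    alphaMeasure (T '' A) ≤ alphaNorm T * alphaMeasure A := by
  have hne : {k : ℝ | 0 < k ∧ ∀ A : Set X, Bornology.IsBounded A →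
      alphaMeasure (T '' A) ≤ k * alphaMeasure A}.Nonempty :=
    ⟨‖T‖ + 1, by positivity, fun A hA => (alphaMeasure_image_le_norm T hA).trans
      (mul_le_mul_of_nonneg_right (by linarith) (alphaMeasure_nonneg A))⟩
  have key : ∀ k > alphaNorm T, alphaMeasure (T '' A) ≤ k * alphaMeasure A := fun k hk => by
    obtain ⟨k', hk', hlt⟩ := exists_lt_of_csInf_lt hne hk
    exact (hk'.2 A hA).trans (mul_le_mul_of_nonneg_right hlt.le (alphaMeasure_nonneg A))
  refine ge_of_tendsto (x := nhdsWithin (alphaNorm T) (Set.Ioi (alphaNorm T)))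
    (f := fun k => k * alphaMeasure A) ?_
    (by filter_upwards [self_mem_nhdsWithin] with k hk using key k hk)
  exact ((continuous_id.mul continuous_const).tendsto _).mono_left nhdsWithin_le_nhds

lemma alphaNorm_le_norm (T : X →L[ℝ] X) : alphaNorm T ≤ ‖T‖ :=
  alphaNorm_le (norm_nonneg T) fun _ hA => alphaMeasure_image_le_norm T hA

lemma alphaNorm_comp_le (T U : X →L[ℝ] X) :
    alphaNorm (T.comp U) ≤ alphaNorm T * alphaNorm U := by
  refine alphaNorm_le (mul_nonneg (alphaNorm_nonneg _) (alphaNorm_nonneg _)) fun A hA => ?_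
  rw [ContinuousLinearMap.coe_comp, Set.image_comp, mul_assoc]
  exact (alphaMeasure_image_le T (U.isBounded_image hA)).trans
    (mul_le_mul_of_nonneg_left (alphaMeasure_image_le U hA) (alphaNorm_nonneg _))

lemma alphaNorm_add_le (T U : X →L[ℝ] X) :
    alphaNorm (T + U : X →L[ℝ] X) ≤ alphaNorm T + alphaNorm U := by
  refine alphaNorm_le (add_nonneg (alphaNorm_nonneg _) (alphaNorm_nonneg _)) fun A hA => ?_
  rw [add_mul]
  exact (alphaMeasure_image_add_le T U hA).trans
    (add_le_add (alphaMeasure_image_le T hA) (alphaMeasure_image_le U hA))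

lemma continuous_alphaNorm : Continuous fun T : X →L[ℝ] X => alphaNorm T := by
  refine (LipschitzWith.of_le_add fun T U => ?_).continuous
  calc alphaNorm T = alphaNorm (U + (T - U) : X →L[ℝ] X) := by rw [add_sub_cancel]
    _ ≤ alphaNorm U + alphaNorm (T - U : X →L[ℝ] X) := alphaNorm_add_le _ _
    _ ≤ alphaNorm U + dist T U := by
      rw [dist_eq_norm]
      gcongr
      exact alphaNorm_le_norm _

end IndexOfCompactness

section RandomComposition

lemma fIter_congr {X : Type*} (f : Fin 2 → X → X) {n : ℕ} {ω ω' : ℕ → Fin 2}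
    (h : ∀ i < n, ω i = ω' i) : fIter f n ω = fIter f n ω' := by
  induction n with
  | zero => rfl
  | succ n ih =>
    funext x
    rw [fIter, fIter, ih fun i hi => h i (hi.trans n.lt_succ_self), h n n.lt_succ_self]

lemma fIter_add {X : Type*} (f : Fin 2 → X → X) (n m : ℕ) (ω : ℕ → Fin 2) :
    fIter f (n + m) ω = fIter f m (shiftSeq^[n] ω) ∘ fIter f n ω := by
  induction m with
  | zero => rfl
  | succ m ih =>
    funext x
    rw [← add_assoc, fIter, ih, Function.comp_apply, Function.comp_apply, fIter, iterate_shiftSeq,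
      add_comm n m]

lemma fIter_one {X : Type*} (f : Fin 2 → X → X) (ω : ℕ → Fin 2) : fIter f 1 ω = f (ω 0) := rfl

lemma fIter_comp_comm {X : Type*} {f : Fin 2 → X → X} (hcomm : ∀ i j, f i ∘ f j = f j ∘ f i)
    (n : ℕ) (ω : ℕ → Fin 2) (i : Fin 2) : fIter f n ω ∘ f i = f i ∘ fIter f n ω := by
  funext x
  induction n with
  | zero => rfl
  | succ n ih =>
    simp only [Function.comp_apply, fIter] at ih ⊢
    rw [ih]
    exact congrFun (hcomm (ω n) i) _

lemma fIter_succ_of_comm {X : Type*} {f : Fin 2 → X → X} (hcomm : ∀ i j, f i ∘ f j = f j ∘ f i)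
    (n : ℕ) (ω : ℕ → Fin 2) : fIter f (n + 1) ω = f (ω 0) ∘ fIter f n (shiftSeq ω) := by
  rw [add_comm, fIter_add, fIter_one, Function.iterate_one, fIter_comp_comm hcomm]

lemma mapsTo_fIter {X : Type*} {f : Fin 2 → X → X} {K : Set X} (hK : ∀ i, Set.MapsTo (f i) K K)
    (n : ℕ) (ω : ℕ → Fin 2) : Set.MapsTo (fIter f n ω) K K := by
  induction n with
  | zero => exact Set.mapsTo_id K
  | succ n ih => exact (hK (ω n)).comp ih

/-- The skew product over the shift driven by the maps `f 0`, `f 1`. -/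
def skewShift {X : Type*} (f : Fin 2 → X → X) (z : (ℕ → Fin 2) × X) : (ℕ → Fin 2) × X :=
  (shiftSeq z.1, f (z.1 0) z.2)

lemma iterate_skewShift {X : Type*} (f : Fin 2 → X → X) (n : ℕ) (z : (ℕ → Fin 2) × X) :
    (skewShift f)^[n] z = (shiftSeq^[n] z.1, fIter f n z.1 z.2) := by
  induction n with
  | zero => rfl
  | succ n ih =>
    rw [Function.iterate_succ_apply', ih, Function.iterate_succ_apply', skewShift, fIter]
    simp [iterate_shiftSeq]

lemma measurePreserving_skewShift {X : Type*} [MeasurableSpace X] {f : Fin 2 → X → X}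
    {μ : Measure X} [SFinite μ] (hf : ∀ i, MeasurePreserving (f i) μ μ)
    {P : Measure (ℕ → Fin 2)} [SFinite P] (hP : MeasurePreserving shiftSeq P P) :
    MeasurePreserving (skewShift f) (P.prod μ) (P.prod μ) := by
  refine hP.skew_product (g := fun ω => f (ω 0)) ?_ (.of_forall fun ω => (hf (ω 0)).map_eq)
  have h : Measurable fun p : Fin 2 × X => f p.1 p.2 :=
    measurable_from_prod_countable_right fun i => (hf i).measurable
  exact h.comp (f := fun z : (ℕ → Fin 2) × X => (z.1 0, z.2)) (by fun_prop)

variable {X : Type*} [NormedAddCommGroup X] [NormedSpace ℝ X]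

lemma contDiff_fIter {f : Fin 2 → X → X} (hf : ∀ i, ContDiff ℝ 1 (f i)) (n : ℕ)
    (ω : ℕ → Fin 2) : ContDiff ℝ 1 (fIter f n ω) := by
  induction n with
  | zero => exact contDiff_id
  | succ n ih => exact (hf (ω n)).comp ih

/-- The positive part of `log ‖d_x f(n, ω)‖_α + n * C`, cut off outside `K`. -/
noncomputable def truncatedGrowth (f : Fin 2 → X → X) (K : Set X) (C : ℝ) (n : ℕ)
    (z : (ℕ → Fin 2) × X) : ℝ :=
  K.indicator
    (fun x => Real.posLog (Real.exp (n * C) * alphaNorm (fderiv ℝ (fIter f n z.1) x))) z.2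

lemma truncatedGrowth_of_mem {f : Fin 2 → X → X} {K : Set X} (C : ℝ) (n : ℕ)
    (ω : ℕ → Fin 2) {x : X} (hx : x ∈ K) : truncatedGrowth f K C n (ω, x) =
      Real.posLog (Real.exp (n * C) * alphaNorm (fderiv ℝ (fIter f n ω) x)) :=
  Set.indicator_of_mem hx _

lemma truncatedGrowth_of_notMem {f : Fin 2 → X → X} {K : Set X} (C : ℝ) (n : ℕ)
    (ω : ℕ → Fin 2) {x : X} (hx : x ∉ K) : truncatedGrowth f K C n (ω, x) = 0 :=
  Set.indicator_of_notMem hx _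

lemma truncatedGrowth_nonneg (f : Fin 2 → X → X) (K : Set X) (C : ℝ) (n : ℕ)
    (z : (ℕ → Fin 2) × X) : 0 ≤ truncatedGrowth f K C n z :=
  Set.indicator_nonneg (fun _ _ => Real.posLog_nonneg) _

lemma measurable_truncatedGrowth [MeasurableSpace X] [BorelSpace X] {f : Fin 2 → X → X}
    (hf : ∀ i, ContDiff ℝ 1 (f i)) {K : Set X} (hK : MeasurableSet K) (C : ℝ) (n : ℕ) :
    Measurable (truncatedGrowth f K C n) := by
  have hx : ∀ ω, Measurable fun x => truncatedGrowth f K C n (ω, x) := fun ω => by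
    refine Measurable.indicator (Continuous.measurable ?_) hK
    exact Real.continuous_posLog.comp (continuous_const.mul
      (continuous_alphaNorm.comp ((contDiff_fIter hf n ω).continuous_fderiv one_ne_zero)))
  let r : (ℕ → Fin 2) → Fin n → Fin 2 := fun ω m => ω m
  let e : (Fin n → Fin 2) → ℕ → Fin 2 := fun a m => if h : m < n then a ⟨m, h⟩ else 0
  have hG : Measurable fun p : (Fin n → Fin 2) × X => truncatedGrowth f K C n (e p.1, p.2) :=
    measurable_from_prod_countable_right fun a => hx (e a)
  have hr : Measurable fun z : (ℕ → Fin 2) × X => (r z.1, z.2) := by fun_prop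
  convert hG.comp hr using 1
  funext z
  have : fIter f n z.1 = fIter f n (e (r z.1)) := fIter_congr f fun i hi => by simp [e, r, hi]
  simp only [truncatedGrowth, Function.comp_apply, this]

/-- Submultiplicativity of the index of compactness under the chain rule, in logarithmic form. -/
lemma posLog_alphaNorm_fderiv_comp_le {g h : X → X} {x : X} (hg : DifferentiableAt ℝ g (h x))
    (hh : DifferentiableAt ℝ h x) (s t : ℝ) :
    Real.posLog (Real.exp (s + t) * alphaNorm (fderiv ℝ (g ∘ h) x)) ≤
      Real.posLog (Real.exp s * alphaNorm (fderiv ℝ g (h x))) +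
        Real.posLog (Real.exp t * alphaNorm (fderiv ℝ h x)) := by
  refine le_trans (Real.posLog_le_posLog ?_ ?_) Real.posLog_mul
  · exact mul_nonneg (Real.exp_pos _).le (alphaNorm_nonneg _)
  · rw [fderiv_comp x hg hh, Real.exp_add, mul_mul_mul_comm]
    exact mul_le_mul_of_nonneg_left (alphaNorm_comp_le _ _) (by positivity)

lemma truncatedGrowth_add_le {f : Fin 2 → X → X} (hf : ∀ i, ContDiff ℝ 1 (f i)) {K : Set X}
    (hK : ∀ i, Set.MapsTo (f i) K K) (C : ℝ) (n m : ℕ) (z : (ℕ → Fin 2) × X) :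
    truncatedGrowth f K C (n + m) z ≤
      truncatedGrowth f K C n z + truncatedGrowth f K C m ((skewShift f)^[n] z) := by
  obtain ⟨ω, x⟩ := z
  by_cases hx : x ∈ K
  · rw [iterate_skewShift, truncatedGrowth_of_mem C _ _ hx, truncatedGrowth_of_mem C _ _ hx,
      truncatedGrowth_of_mem C _ _ (mapsTo_fIter hK n ω hx), fIter_add, add_comm (Real.posLog _),
      Nat.cast_add, add_comm (n : ℝ), add_mul]
    exact posLog_alphaNorm_fderiv_comp_le
      ((contDiff_fIter hf m _).differentiable one_ne_zero _)
      ((contDiff_fIter hf n _).differentiable one_ne_zero _) _ _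
  · rw [truncatedGrowth_of_notMem C _ _ hx]
    exact add_nonneg (truncatedGrowth_nonneg ..) (truncatedGrowth_nonneg ..)

lemma isBddSubadditive_truncatedGrowth [MeasurableSpace X] [BorelSpace X] {f : Fin 2 → X → X}
    (hf : ∀ i, ContDiff ℝ 1 (f i)) {K : Set X} (hKm : MeasurableSet K)
    (hK : ∀ i, Set.MapsTo (f i) K K) {R : ℝ}
    (hR : ∀ i, ∀ x ∈ K, alphaNorm (fderiv ℝ (f i) x) ≤ R) (C : ℝ) :
    IsBddSubadditive (skewShift f) (truncatedGrowth f K C)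
      (Real.posLog (Real.exp C * R)) where
  measurable := measurable_truncatedGrowth hf hKm C
  nonneg := truncatedGrowth_nonneg f K C
  add_le := truncatedGrowth_add_le hf hK C
  le_mul n z := by
    have h1 : ∀ z, truncatedGrowth f K C 1 z ≤ Real.posLog (Real.exp C * R) := by
      rintro ⟨ω, x⟩
      by_cases hx : x ∈ K
      · rw [truncatedGrowth_of_mem C _ _ hx, fIter_one, Nat.cast_one, one_mul]
        exact Real.posLog_le_posLog (mul_nonneg (Real.exp_pos _).le (alphaNorm_nonneg _))
          (mul_le_mul_of_nonneg_left (hR _ _ hx) (Real.exp_pos _).le)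
      · rw [truncatedGrowth_of_notMem C _ _ hx]
        exact Real.posLog_nonneg
    induction n with
    | zero =>
      obtain ⟨ω, x⟩ := z
      by_cases hx : x ∈ K
      · have hid : fderiv ℝ (fIter f 0 ω) x = ContinuousLinearMap.id ℝ X := fderiv_id
        rw [truncatedGrowth_of_mem C _ _ hx, hid]
        have h2 : alphaNorm (ContinuousLinearMap.id ℝ X) ≤ 1 :=
          (alphaNorm_le_norm _).trans ContinuousLinearMap.norm_id_le
        have := Real.posLog_le_posLog (alphaNorm_nonneg _) h2
        simpa [Real.posLog] using this
      · simp [truncatedGrowth_of_notMem C _ _ hx]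
    | succ n ih =>
      refine (truncatedGrowth_add_le hf hK C n 1 z).trans ?_
      push_cast
      linarith [h1 ((skewShift f)^[n] z)]

/-- For commuting maps, deleting the first letter of `ω` costs a bounded amount, with the base
point kept fixed. -/
lemma truncatedGrowth_succ_le {f : Fin 2 → X → X} (hf : ∀ i, ContDiff ℝ 1 (f i))
    (hcomm : ∀ i j, f i ∘ f j = f j ∘ f i) {K : Set X}
    (hK : ∀ i, Set.MapsTo (f i) K K) {R : ℝ}
    (hR : ∀ i, ∀ x ∈ K, alphaNorm (fderiv ℝ (f i) x) ≤ R) (C : ℝ) (n : ℕ)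
    (ω : ℕ → Fin 2) (x : X) : truncatedGrowth f K C (n + 1) (ω, x) ≤
      Real.posLog (Real.exp C * R) + truncatedGrowth f K C n (shiftSeq ω, x) := by
  by_cases hx : x ∈ K
  · rw [truncatedGrowth_of_mem C _ _ hx, truncatedGrowth_of_mem C _ _ hx,
      fIter_succ_of_comm hcomm, Nat.cast_add_one, add_mul, one_mul, add_comm (_ * _)]
    refine (posLog_alphaNorm_fderiv_comp_le ((hf _).differentiable one_ne_zero _)
      ((contDiff_fIter hf n _).differentiable one_ne_zero _) _ _).trans ?_
    refine add_le_add_left (Real.posLog_le_posLog (mul_nonneg (Real.exp_pos _).le (alphaNorm_nonneg _))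
      (mul_le_mul_of_nonneg_left (hR _ _ (mapsTo_fIter hK n _ hx)) (Real.exp_pos _).le)) _
  · rw [truncatedGrowth_of_notMem C _ _ hx]
    exact add_nonneg Real.posLog_nonneg (truncatedGrowth_nonneg ..)

end RandomComposition

section ExtendedLog

lemma posLog_exp_mul_div_sub {a : ℝ} (ha : 0 ≤ a) (C : ℝ) {n : ℕ} (hn : 0 < n) :
    ((Real.posLog (Real.exp (n * C) * a) / n - C : ℝ) : EReal) =
      max ((-C : ℝ) : EReal) ((((n : ℝ)⁻¹ : ℝ) : EReal) * elog a) := by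
  have hn' : (0 : ℝ) < n := by exact_mod_cast hn
  rcases ha.eq_or_lt with rfl | ha
  · have : (((n : ℝ)⁻¹ : ℝ) : EReal) * ⊥ = ⊥ := EReal.coe_mul_bot_of_pos (inv_pos.2 hn')
    simp [elog, Real.posLog, this]
  · rw [elog, if_neg ha.not_ge, ← EReal.coe_mul, ← EReal.coe_strictMono.monotone.map_max, Real.posLog,
      Real.log_mul (Real.exp_pos _).ne' ha.ne', Real.log_exp]
    congr 1
    rw [← max_div_div_right hn'.le, ← max_sub_sub_right, zero_div, zero_sub]
    congr 1
    field_simp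
    ring

/-- A sequence of extended reals whose truncations from below at all negative integers converge
to real numbers converges to the infimum of these limits. -/
lemma tendsto_iInf_of_tendsto_max {s : ℕ → EReal} {l : ℕ → ℝ}
    (h : ∀ C : ℕ, Tendsto (fun n => max ((-(C : ℝ) : ℝ) : EReal) (s n)) atTop
      (nhds ((l C : ℝ) : EReal))) :
    Tendsto s atTop (nhds (⨅ C, ((l C : ℝ) : EReal))) := by
  refine tendsto_order.2 ⟨fun a ha => ?_, fun a ha => ?_⟩
  · obtain ⟨b, hab, hb⟩ := exists_between ha
    lift b to ℝ using ⟨(hb.trans_le le_top).ne, (bot_le.trans_lt hab).ne'⟩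
    obtain ⟨C, hC⟩ := exists_nat_gt (-b)
    have hCb : ((-(C : ℝ) : ℝ) : EReal) < b := EReal.coe_lt_coe_iff.2 (by linarith)
    filter_upwards [(h C).eventually (lt_mem_nhds (hb.trans_le (iInf_le _ C)))] with n hn
    exact hab.trans ((lt_max_iff.1 hn).resolve_left hCb.not_gt)
  · obtain ⟨C, hC⟩ := iInf_lt_iff.1 ha
    filter_upwards [(h C).eventually (gt_mem_nhds hC)] with n hn
    exact (le_max_right _ _).trans_lt hn

end ExtendedLog

/-- Let `f_1, f_2` be commuting `C¹` maps of a Banach space `X`, `K` a nonempty compact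
set invariant under both, and `μ` a Borel probability measure supported on `K` invariant
under both generators.  Then there are a Borel function `l_α : X → [-∞, ∞)` and a Borel
set `Γ₀` of full `μ`-measure such that for every `x ∈ Γ₀`, for `P_ν`-a.e. `ω` the limit
`lim (1/n) log ‖d_x f(n, ω)‖_α` exists and equals `l_α(x)`; in particular the limit is
`P_ν`-a.s. independent of `ω`. -/
theorem exists_nonrandom_lAlpha
    {X : Type*} [NormedAddCommGroup X] [NormedSpace ℝ X] [CompleteSpace X]
    [MeasurableSpace X] [BorelSpace X]
    (f : Fin 2 → X → X) (hf : ∀ i, ContDiff ℝ 1 (f i))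
    (hcomm : f 0 ∘ f 1 = f 1 ∘ f 0)
    (K : Set X) (hK : IsCompact K) (hKne : K.Nonempty) (hinv : ∀ i, f i '' K = K)
    (μ : Measure X) [IsProbabilityMeasure μ]
    (hμinv : ∀ i, MeasurePreserving (f i) μ μ) (hsupp : μ K = 1)
    (ν : Fin 2 → ℝ) (hν : ∀ i, 0 < ν i) (hνsum : ν 0 + ν 1 = 1)
    (P : Measure (ℕ → Fin 2)) [IsProbabilityMeasure P]
    (hP : ∀ (n : ℕ) (a : Fin n → Fin 2),
      P {ω | ∀ m : Fin n, ω m = a m} = ENNReal.ofReal (∏ m : Fin n, ν (a m))) :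
    ∃ (lα : X → EReal) (Γ₀ : Set X),
      Measurable lα ∧ (∀ x, lα x ≠ ⊤) ∧ MeasurableSet Γ₀ ∧ μ Γ₀ = 1 ∧
      ∀ x ∈ Γ₀, ∀ᵐ ω ∂P,
        Filter.Tendsto
          (fun n : ℕ => (((n : ℝ)⁻¹ : ℝ) : EReal) *
            elog (alphaNorm (⇑(fderiv ℝ (fIter f n ω) x))))
          Filter.atTop (nhds (lα x)) := by
  have hcomm' : ∀ i j, f i ∘ f j = f j ∘ f i := by
    intro i j
    fin_cases i <;> fin_cases j <;> first | rfl | exact hcomm | exact hcomm.symm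
  have hKm : MeasurableSet K := hK.isClosed.measurableSet
  have hmaps : ∀ i, Set.MapsTo (f i) K K := fun i => Set.mapsTo_iff_image_subset.2 (hinv i).subset
  obtain ⟨R, hR⟩ : ∃ R, ∀ i, ∀ x ∈ K, alphaNorm (fderiv ℝ (f i) x) ≤ R := by
    have hbd : ∀ i, ∃ R, ∀ x ∈ K, alphaNorm (fderiv ℝ (f i) x) ≤ R := fun i => by
      obtain ⟨R, hR⟩ := hK.bddAbove_image
        (continuous_alphaNorm.comp ((hf i).continuous_fderiv one_ne_zero)).continuousOn
      exact ⟨R, fun x hx => hR (Set.mem_image_of_mem _ hx)⟩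
    choose R hR using hbd
    exact ⟨⨆ i, R i, fun i x hx => (hR i x hx).trans (le_ciSup (Set.finite_range R).bddAbove i)⟩
  obtain ⟨p, hp, rfl⟩ : ∃ p : Measure (Fin 2), ∃ _ : IsProbabilityMeasure p,
      P = Measure.infinitePi fun _ : ℕ => p := by
    let p : Measure (Fin 2) := ∑ i, ENNReal.ofReal (ν i) • Measure.dirac i
    have hpi : ∀ i, p {i} = ENNReal.ofReal (ν i) := fun i => by
      fin_cases i <;> simp [p, Fin.sum_univ_two]
    have hp : IsProbabilityMeasure p := ⟨by
      simp [p, Fin.sum_univ_two, ← ENNReal.ofReal_add (hν 0).le (hν 1).le, hνsum]⟩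
    refine ⟨p, hp, eq_infinitePi_of_initial_cylinders p P fun n a => ?_⟩
    rw [hP, ENNReal.ofReal_prod_of_nonneg fun m _ => (hν (a m)).le]
    simp [hpi]
  set P : Measure (ℕ → Fin 2) := Measure.infinitePi fun _ => p
  have herg : Ergodic shiftSeq P := ergodic_shift_infinitePi p
  have hF := measurePreserving_skewShift hμinv herg.toMeasurePreserving
  have hsub := fun C : ℕ => isBddSubadditive_truncatedGrowth hf hKm hmaps hR C
  let L : ℕ → (ℕ → Fin 2) × X → ℝ := fun C => lowerRate (truncatedGrowth f K C)
  have hLm : ∀ C, Measurable (L C) := fun C => (hsub C).measurable_lowerRate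
  let l : ℕ → X → ℝ := fun C x => ∫ ω, L C (ω, x) ∂P
  have hl : ∀ C, Measurable (l C) := fun C =>
    (hLm C).stronglyMeasurable.integral_prod_left'.measurable
  have hconst : ∀ C x, ∀ᵐ ω ∂P, L C (ω, x) = l C x := fun C x => by
    have hm : Measurable fun ω => L C (ω, x) := (hLm C).comp (by fun_prop)
    have hint : Integrable (fun ω => L C (ω, x)) P :=
      Integrable.of_bound hm.aestronglyMeasurable _ (.of_forall fun ω => by
        rw [Real.norm_of_nonneg ((hsub C).lowerRate_nonneg _)]
        exact (hsub C).lowerRate_le _)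
    have hle : ∀ ω, L C (ω, x) ≤ L C (shiftSeq ω, x) := fun ω =>
      (hsub C).lowerRate_le_lowerRate fun n =>
        truncatedGrowth_succ_le hf hcomm' hmaps hR C n ω x
    obtain ⟨c, hc⟩ := herg.ae_eq_const_of_ae_eq_comp_ae hm.aestronglyMeasurable
      (ae_eq_comp_of_le_comp herg.toMeasurePreserving hint hle)
    have hlc : l C x = c := by simpa using integral_congr_ae hc
    rw [hlc]
    exact hc
  have hlim : ∀ᵐ x ∂μ, ∀ᵐ ω ∂P, ∀ C : ℕ,
      Tendsto (fun n : ℕ => truncatedGrowth f K C n (ω, x) / n) atTop (nhds (L C (ω, x))) :=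
    Measure.ae_ae_of_ae_prod (Measure.measurePreserving_swap.quasiMeasurePreserving.ae
      (ae_all_iff.2 fun C => (hsub C).ae_tendsto hF))
  have hK1 : ∀ᵐ x ∂μ, x ∈ K := (mem_ae_iff_prob_eq_one hKm).2 hsupp
  obtain ⟨N, hN, hNm, hN0⟩ := exists_measurable_superset_of_null (ae_iff.1 (hlim.and hK1))
  refine ⟨fun x => ⨅ C : ℕ, ((l C x - C : ℝ) : EReal), Nᶜ,
    .iInf fun C => ((hl C).sub_const _).coe_real_ereal,
    fun x => ((iInf_le (fun C : ℕ => ((l C x - C : ℝ) : EReal)) 0).trans_lt (EReal.coe_lt_top _)).ne, hNm.compl,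
    (prob_compl_eq_one_iff hNm).2 hN0, fun x hx => ?_⟩
  obtain ⟨hx1, hxK⟩ := not_not.1 fun h => hx (hN h)
  filter_upwards [hx1, ae_all_iff.2 fun C => hconst C x] with ω hω hωc
  refine tendsto_iInf_of_tendsto_max fun C => ?_
  have h := (continuous_coe_real_ereal.tendsto _).comp ((hω C).sub_const (C : ℝ))
  rw [hωc C] at h
  refine h.congr' ?_
  filter_upwards [eventually_gt_atTop 0] with n hn
  rw [Function.comp_apply, truncatedGrowth_of_mem _ _ _ hxK]
  exact posLog_exp_mul_div_sub (alphaNorm_nonneg _) C hn
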